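/- A graph is 3-edge bottlenecked if and only if the intersection of any two distinct cycles is empty or connected. -/

import Mathlib

open SimpleGraph

variable {V : Type}

/-- A set of vertices is connected if the induced subgraph is connected. -/
def ConnSet (G : SimpleGraph V) (X : Set V) : Prop := (G.induce X).Connected

/-- `G` is `n`-edge bottlenecked: any two disjoint connected vertex sets `X,Y`
admit a set of at most `n` edges meeting every `X,Y` path. -/
def EdgeBottlenecked (G : SimpleGraph V) (n : ℕ) : Prop :=
  ∀ X Y : Set V, Disjoint X Y → ConnSet G X → ConnSet G Y →
    ∃ S : Finset (Sym2 V), S.card ≤ n ∧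
      ∀ ⦃x y : V⦄ (p : G.Walk x y), x ∈ X → y ∈ Y → p.IsPath → ∃ e ∈ S, e ∈ p.edges

/-- `G` is `n`-point bottlenecked: any two disjoint connected vertex sets `X,Y`
admit a set of at most `n` vertices meeting every `X,Y` path. -/
def PointBottlenecked (G : SimpleGraph V) (n : ℕ) : Prop :=
  ∀ X Y : Set V, Disjoint X Y → ConnSet G X → ConnSet G Y →
    ∃ S : Finset V, S.card ≤ n ∧
      ∀ ⦃x y : V⦄ (p : G.Walk x y), x ∈ X → y ∈ Y → p.IsPath → ∃ v ∈ S, v ∈ p.support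

/-- An `n`-ladder: two disjoint connected poles `X,Y` and `n` rungs, i.e. `X,Y`
paths that are pairwise disjoint outside of `X ∪ Y`. -/
structure Ladder (G : SimpleGraph V) (n : ℕ) where
  X : Set V
  Y : Set V
  disj : Disjoint X Y
  connX : ConnSet G X
  connY : ConnSet G Y
  a : Fin n → V
  b : Fin n → V
  ha : ∀ i, a i ∈ X
  hb : ∀ i, b i ∈ Y
  p : (i : Fin n) → G.Walk (a i) (b i)
  isPath : ∀ i, (p i).IsPath
  rungsDisj : ∀ i j, i ≠ j → ∀ v, v ∈ (p i).support → v ∈ (p j).support → v ∈ X ∪ Y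

/-- `G` contains the dipole `D_k` as a minor: equivalently, `G` contains a `k`-ladder. -/
def HasDipoleMinor (G : SimpleGraph V) (k : ℕ) : Prop := Nonempty (Ladder G k)

/-- Two vertex sets are `M`-disjoint if every pair of points (one from each) is at
graph distance at least `M`. -/
def MDisjoint (G : SimpleGraph V) (M : ℕ) (X Y : Set V) : Prop :=
  ∀ x ∈ X, ∀ y ∈ Y, M ≤ G.dist x y

/-- `G` is `M`-fat `n`-bottlenecked: any two connected `M`-disjoint sets `X,Y` admit
at most `n` vertices (outside `X ∪ Y`) whose open `M`-neighborhood meets every `X,Y` path. -/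
def FatBottlenecked (G : SimpleGraph V) (M n : ℕ) : Prop :=
  ∀ X Y : Set V, ConnSet G X → ConnSet G Y → MDisjoint G M X Y →
    ∃ S : Finset V, S.card ≤ n ∧ (∀ s ∈ S, s ∉ X ∪ Y) ∧
      ∀ ⦃x y : V⦄ (p : G.Walk x y), x ∈ X → y ∈ Y → p.IsPath →
        ∃ v ∈ p.support, ∃ s ∈ S, G.dist v s < M

/-- An `M`-fat `n`-ladder: an `n`-ladder whose poles are `M`-disjoint and whose
rungs are pairwise `M`-disjoint. -/
structure FatLadder (G : SimpleGraph V) (M n : ℕ) extends Ladder G n where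
  polesFat : MDisjoint G M X Y
  rungsFat : ∀ i j, i ≠ j → ∀ u v, u ∈ (p i).support → v ∈ (p j).support → M ≤ G.dist u v

/-- `H` is a minor of `G`: branch sets in `G` (nonempty, connected, pairwise disjoint)
realize the vertices of `H`, and every edge of `H` is realized by an edge of `G`. -/
def IsMinor {W : Type} (G : SimpleGraph V) (H : SimpleGraph W) : Prop :=
  ∃ B : W → Set V, (∀ w, (B w).Nonempty) ∧ (∀ w, ConnSet G (B w)) ∧
    (∀ w w', w ≠ w' → Disjoint (B w) (B w')) ∧
    (∀ ⦃w w'⦄, H.Adj w w' → ∃ u ∈ B w, ∃ v ∈ B w', G.Adj u v)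

/-- `H` is an `M`-fat minor of `G`: a minor whose branch sets are pairwise `M`-disjoint
except where incident (adjacent) in `H`. -/
def IsFatMinor (G : SimpleGraph V) (M : ℕ) {W : Type} (H : SimpleGraph W) : Prop :=
  ∃ B : W → Set V, (∀ w, (B w).Nonempty) ∧ (∀ w, ConnSet G (B w)) ∧
    (∀ w w', w ≠ w' → Disjoint (B w) (B w')) ∧
    (∀ w w', w ≠ w' → ¬ H.Adj w w' → MDisjoint G M (B w) (B w')) ∧
    (∀ ⦃w w'⦄, H.Adj w w' → ∃ u ∈ B w, ∃ v ∈ B w', G.Adj u v)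

/-- Splitting a walk at one of its edges. -/
lemma cc_split_edge {G : SimpleGraph V} {u v : V} (p : G.Walk u v) (e : Sym2 V) (he : e ∈ p.edges) :
    ∃ (a b : V) (h : G.Adj a b) (q : G.Walk u a) (r : G.Walk b v),
      e = s(a, b) ∧ p = q.append (Walk.cons h r) := by
  induction p with
  | nil => simp at he
  | @cons x y z h p ih =>
    rw [Walk.edges_cons, List.mem_cons] at he
    rcases he with rfl | he
    · exact ⟨x, y, h, Walk.nil, p, rfl, rfl⟩
    · obtain ⟨a, b, h', q, r, h1, h2⟩ := ih he
      exact ⟨a, b, h', Walk.cons h q, r, h1, by rw [h2]; rfl⟩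

lemma cc_connSet_union {G : SimpleGraph V} {a b c d w : V} (p : G.Walk a b) (q : G.Walk c d)
    (hp : w ∈ p.support) (hq : w ∈ q.support) :
    ConnSet G ({x | x ∈ p.support} ∪ {x | x ∈ q.support}) :=
  induce_union_connected p.connected_induce_support.preconnected
    q.connected_induce_support.preconnected ⟨w, hp, hq⟩

lemma cc_forward (G : SimpleGraph V) (hG : EdgeBottlenecked G 3) {z₁ z₂ : V}
    (c₁ : G.Walk z₁ z₁) (c₂ : G.Walk z₂ z₂) (h₁ : c₁.IsCycle) (h₂ : c₂.IsCycle)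
    (hne : (c₁.toSubgraph ⊓ c₂.toSubgraph).verts.Nonempty) :
    (c₁.toSubgraph ⊓ c₂.toSubgraph).Connected := by
  classical
  rw [Subgraph.connected_iff_forall_exists_walk_subgraph]
  refine ⟨hne, ?_⟩
  intro u v hu hv
  by_contra hno
  push Not at hno
  have huv : u ≠ v := by
    rintro rfl
    refine hno Walk.nil ?_
    simpa using hu
  simp only [Subgraph.verts_inf, Set.mem_inter_iff, Walk.mem_verts_toSubgraph] at hu hv
  have key : ∀ w : G.Walk u v, w.edges ⊆ c₁.edges → ∃ e ∈ w.edges, e ∉ c₂.edges := by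
    intro w hw
    by_contra hcon
    push Not at hcon
    apply hno w
    rw [Walk.toSubgraph_le_iff (Walk.not_nil_of_ne huv)]
    intro e he
    have he' : e ∈ w.edges := he
    rw [Subgraph.edgeSet_inf]
    exact ⟨(Walk.mem_edges_toSubgraph _).2 (hw he'), (Walk.mem_edges_toSubgraph _).2 (hcon e he')⟩
  have hd₁ := (h₁.rotate hu.1)
  have hd₂ := (h₂.rotate hu.2)
  have hv₁ : v ∈ (c₁.rotate u hu.1).support := by simpa using hv.1
  have hv₂ : v ∈ (c₂.rotate u hu.2).support := by simpa using hv.2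
  have hE₁ : ∀ e, e ∈ (c₁.rotate u hu.1).edges → e ∈ c₁.edges := fun e he =>
    (c₁.rotate_edges _ hu.1).mem_iff.1 he
  have hE₂ : ∀ e, e ∈ (c₂.rotate u hu.2).edges → e ∈ c₂.edges := fun e he =>
    (c₂.rotate_edges _ hu.2).mem_iff.1 he
  generalize c₁.rotate u hu.1 = d₁ at hd₁ hv₁ hE₁
  generalize c₂.rotate u hu.2 = d₂ at hd₂ hv₂ hE₂
  obtain ⟨w₁, w₂, rfl⟩ := d₁.mem_support_iff_exists_append.1 hv₁
  obtain ⟨t₁, t₂, rfl⟩ := d₂.mem_support_iff_exists_append.1 hv₂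
  obtain ⟨e, he, hec⟩ := key w₁ (fun e he => hE₁ e (by simp [he]))
  obtain ⟨f, hf, hfc⟩ := key w₂.reverse (fun e he => hE₁ e (by
    rw [Walk.edges_reverse, List.mem_reverse] at he
    simp [he]))
  rw [Walk.edges_reverse, List.mem_reverse] at hf
  obtain ⟨a₁, b₁, k₁, q₁, r₁, rfl, rfl⟩ := cc_split_edge w₁ e he
  obtain ⟨a₂, b₂, k₂, q₂, r₂, rfl, rfl⟩ := cc_split_edge w₂ f hf
  have hnd := hd₁.support_nodup
  have htr := hd₁.isTrail
  have htr₂ := hd₂.isTrail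
  rw [Walk.isTrail_append] at htr htr₂
  have hef : s(a₁, b₁) ≠ s(a₂, b₂) := by
    intro h
    have hdj := htr.2.2
    exact @hdj s(a₁, b₁) (by simp) (by rw [h]; simp)
  have hX := cc_connSet_union q₁ r₂ (w := u) (by simp) (by simp)
  have hY := cc_connSet_union r₁ q₂ (w := v) (by simp) (by simp)
  have hdisj : Disjoint ({x | x ∈ q₁.support} ∪ {x | x ∈ r₂.support})
      ({x | x ∈ r₁.support} ∪ {x | x ∈ q₂.support}) := by
    rw [Set.disjoint_left]
    have hq₁ : ∀ x, x ∈ q₁.support → x ∈ q₁.support.tail ∨ x ∈ r₂.support := by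
      intro x hx
      rcases (Walk.mem_support_iff q₁).1 hx with rfl | h
      · right; simp
      · left; exact h
    have hq₂ : ∀ x, x ∈ q₂.support → x ∈ q₂.support.tail ∨ x ∈ r₁.support := by
      intro x hx
      rcases (Walk.mem_support_iff q₂).1 hx with rfl | h
      · right; simp
      · left; exact h
    simp only [Walk.tail_support_append, Walk.support_cons, List.tail_cons] at hnd
    rw [List.nodup_append', List.nodup_append', List.nodup_append'] at hnd
    obtain ⟨⟨-, -, hA⟩, ⟨-, -, hB⟩, hC⟩ := hnd
    intro x hx hy
    have hx' : x ∈ q₁.support.tail ∨ x ∈ r₂.support := by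
      rcases hx with hx | hx
      · exact hq₁ x hx
      · exact Or.inr hx
    have hy' : x ∈ q₂.support.tail ∨ x ∈ r₁.support := by
      rcases hy with hy | hy
      · exact Or.inr hy
      · exact hq₂ x hy
    rcases hx' with hx' | hx' <;> rcases hy' with hy' | hy'
    · exact hC (List.mem_append_left _ hx') (List.mem_append_left _ hy')
    · exact hA hx' hy'
    · exact hB hy' hx'
    · exact hC (List.mem_append_right _ hy') (List.mem_append_right _ hx')
  obtain ⟨S, hS, hcut⟩ := hG _ _ hdisj hX hY
  have hcut' : ∀ ⦃x y : V⦄ (p : G.Walk x y), (x ∈ q₁.support ∨ x ∈ r₂.support) →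
      (y ∈ r₁.support ∨ y ∈ q₂.support) → ∃ e ∈ S, e ∈ p.edges := by
    intro x y p hx hy
    obtain ⟨e, he, hep⟩ := hcut p.bypass hx hy p.bypass_isPath
    exact ⟨e, he, p.edges_bypass_subset_edges hep⟩
  obtain ⟨e₁, he₁, h⟩ := hcut' (Walk.cons k₁ Walk.nil) (Or.inl (by simp)) (Or.inl (by simp))
  obtain rfl : e₁ = s(a₁, b₁) := by simpa using h
  obtain ⟨e₂, he₂, h⟩ := hcut' (Walk.cons k₂.symm Walk.nil) (Or.inr (by simp)) (Or.inr (by simp))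
  obtain rfl : e₂ = s(a₂, b₂) := by rw [Sym2.eq_swap]; simpa using h
  obtain ⟨e₃, he₃, h₃⟩ := hcut' t₁ (Or.inl (by simp)) (Or.inl (by simp))
  obtain ⟨e₄, he₄, h₄⟩ := hcut' t₂.reverse (Or.inl (by simp)) (Or.inl (by simp))
  rw [Walk.edges_reverse, List.mem_reverse] at h₄
  have h34 : e₃ ≠ e₄ := by
    rintro rfl
    exact htr₂.2.2 h₃ h₄
  have h3c := hE₂ e₃ (by simp [h₃])
  have h4c := hE₂ e₄ (by simp [h₄])
  have hsub : ({s(a₁, b₁), s(a₂, b₂), e₃, e₄} : Finset (Sym2 V)) ⊆ S := by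
    intro x hx
    simp only [Finset.mem_insert, Finset.mem_singleton] at hx
    rcases hx with rfl | rfl | rfl | rfl <;> assumption
  have hcard : ({s(a₁, b₁), s(a₂, b₂), e₃, e₄} : Finset (Sym2 V)).card = 4 := by
    rw [Finset.card_insert_of_notMem, Finset.card_insert_of_notMem, Finset.card_pair h34]
    · simp only [Finset.mem_insert, Finset.mem_singleton, not_or]
      exact ⟨fun h => hfc (h ▸ h3c), fun h => hfc (h ▸ h4c)⟩
    · simp only [Finset.mem_insert, Finset.mem_singleton, not_or]
      exact ⟨hef, fun h => hec (h ▸ h3c), fun h => hec (h ▸ h4c)⟩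
  have := Finset.card_le_card hsub
  omega

/-- Two paths inside `X`, joining `a` to `b` and `c` to `d`, which share a vertex. -/
def CCMeet (G : SimpleGraph V) (X : Set V) (a b c d : V) : Prop :=
  ∃ (p : G.Walk a b) (q : G.Walk c d), p.IsPath ∧ q.IsPath ∧ (∀ x ∈ p.support, x ∈ X) ∧
    (∀ x ∈ q.support, x ∈ X) ∧ ∃ w, w ∈ p.support ∧ w ∈ q.support

/-- Any two vertices of `X` are joined by a walk inside `X`. -/
def CCWalkConn (G : SimpleGraph V) (X : Set V) : Prop :=
  ∀ a ∈ X, ∀ b ∈ X, ∃ p : G.Walk a b, ∀ x ∈ p.support, x ∈ X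

lemma CCMeet.swap_right {G : SimpleGraph V} {X : Set V} {a b c d : V} (h : CCMeet G X a b c d) :
    CCMeet G X a b d c := by
  obtain ⟨p, q, h1, h2, h3, h4, w, h5, h6⟩ := h
  exact ⟨p, q.reverse, h1, h2.reverse, h3, by simpa using h4, w, h5, by simpa using h6⟩

lemma cc_path_append {G : SimpleGraph V} {a b c : V} {p : G.Walk a b} {q : G.Walk b c}
    (hp : p.IsPath) (hq : q.IsPath) (h : ∀ x, x ∈ p.support → x ∈ q.support → x = b) :
    (p.append q).IsPath := by
  rw [Walk.isPath_def, Walk.support_append, List.nodup_append']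
  have hq' := hq.support_nodup
  refine ⟨hp.support_nodup, hq'.tail, ?_⟩
  intro x hx hx'
  have := h x hx (List.mem_of_mem_tail hx')
  subst this
  rw [← Walk.cons_tail_support] at hq'
  exact (List.nodup_cons.1 hq').1 hx'

lemma cc_meet {G : SimpleGraph V} {X : Set V} (hX : CCWalkConn G X) {x₁ x₂ x₃ x₄ : V}
    (h₁ : x₁ ∈ X) (h₂ : x₂ ∈ X) (h₃ : x₃ ∈ X) (h₄ : x₄ ∈ X) :
    CCMeet G X x₁ x₂ x₃ x₄ ∨ CCMeet G X x₁ x₃ x₂ x₄ := by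
  classical
  have hP : ∀ a ∈ X, ∀ b ∈ X, ∃ p : G.Walk a b, p.IsPath ∧ ∀ x ∈ p.support, x ∈ X := by
    intro a ha b hb
    obtain ⟨p, hp⟩ := hX a ha b hb
    exact ⟨p.bypass, p.bypass_isPath, fun x hx => hp x (p.support_bypass_subset_support hx)⟩
  obtain ⟨p, hp, hpX⟩ := hP x₁ h₁ x₂ h₂
  obtain ⟨q, hq, hqX⟩ := hP x₃ h₃ x₄ h₄
  by_cases hdis : ∃ w, w ∈ p.support ∧ w ∈ q.support
  · exact Or.inl ⟨p, q, hp, hq, hpX, hqX, hdis⟩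
  right
  push Not at hdis
  let Q : ℕ → Prop := fun n => ∃ (a b : V) (r : G.Walk a b), a ∈ p.support ∧ b ∈ q.support ∧
    (∀ x ∈ r.support, x ∈ X) ∧ r.length = n
  have hex : ∃ n, Q n := by
    obtain ⟨r, -, hr⟩ := hP x₁ h₁ x₃ h₃
    exact ⟨_, x₁, x₃, r, by simp, by simp, hr, rfl⟩
  obtain ⟨a, b, r, ha, hb, hrX, hlen⟩ := Nat.find_spec hex
  have hmin : ∀ (a' b' : V) (r' : G.Walk a' b'), a' ∈ p.support → b' ∈ q.support →
      (∀ x ∈ r'.support, x ∈ X) → r.length ≤ r'.length := by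
    intro a' b' r' ha' hb' hr'
    rw [hlen]
    exact Nat.find_min' hex ⟨a', b', r', ha', hb', hr', rfl⟩
  have hra : ∀ x, x ∈ r.support → x ∈ p.support → x = a := by
    intro x hx hxp
    by_contra hne
    have h1 := Walk.length_dropUntil_lt_length hx hne
    have h2 := hmin x b (r.dropUntil x hx) hxp hb
      (fun y hy => hrX y (r.support_dropUntil_subset_support hx hy))
    omega
  have hrb : ∀ x, x ∈ r.support → x ∈ q.support → x = b := by
    intro x hx hxq
    by_contra hne
    have h1 := Walk.length_takeUntil_lt_length hx hne
    have h2 := hmin a x (r.takeUntil x hx) ha hxq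
      (fun y hy => hrX y (r.support_takeUntil_subset_support hx hy))
    omega
  have hrsub := r.support_bypass_subset_support
  have hrp := r.bypass_isPath
  generalize r.bypass = r' at hrsub hrp
  have hcat : ∀ {s t : V} (p' : G.Walk s a) (q' : G.Walk b t), p'.IsPath → q'.IsPath →
      p'.support ⊆ p.support → q'.support ⊆ q.support →
      ((p'.append r').append q').IsPath ∧ (∀ x ∈ ((p'.append r').append q').support, x ∈ X) ∧
        a ∈ ((p'.append r').append q').support := by
    intro s t p' q' hp' hq' hps hqs
    refine ⟨cc_path_append (cc_path_append hp' hrp ?_) hq' ?_, ?_, by simp⟩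
    · intro x hx hx'
      exact hra x (hrsub hx') (hps hx)
    · intro x hx hx'
      rcases (Walk.mem_support_append_iff _ _).1 hx with hx | hx
      · exact absurd (hqs hx') (hdis x (hps hx))
      · exact hrb x (hrsub hx) (hqs hx')
    · intro x hx
      rcases (Walk.mem_support_append_iff _ _).1 hx with hx | hx
      · rcases (Walk.mem_support_append_iff _ _).1 hx with hx | hx
        · exact hpX x (hps hx)
        · exact hrX x (hrsub hx)
      · exact hqX x (hqs hx)
  have A := hcat (p.takeUntil a ha) (q.takeUntil b hb).reverse (hp.takeUntil ha)
    (hq.takeUntil hb).reverse (p.support_takeUntil_subset_support ha) (by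
      intro x hx
      rw [Walk.support_reverse, List.mem_reverse] at hx
      exact q.support_takeUntil_subset_support hb hx)
  have B := hcat (p.dropUntil a ha).reverse (q.dropUntil b hb) (hp.dropUntil ha).reverse
    (hq.dropUntil hb) (by
      intro x hx
      rw [Walk.support_reverse, List.mem_reverse] at hx
      exact p.support_dropUntil_subset_support ha hx) (q.support_dropUntil_subset_support hb)
  exact ⟨_, _, A.1, B.1, A.2.1, B.2.1, a, A.2.2, B.2.2⟩

/-- The cycle made of a path in `X`, a path in `Y` and two crossing edges. -/
lemma cc_cycle {G : SimpleGraph V} {X Y : Set V} (hXY : Disjoint X Y) {x₁ x₂ y₁ y₂ : V}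
    (a₁ : G.Adj x₁ y₁) (a₂ : G.Adj x₂ y₂) (hne : (x₁, y₁) ≠ (x₂, y₂))
    (p : G.Walk x₁ x₂) (q : G.Walk y₁ y₂) (hp : p.IsPath) (hq : q.IsPath)
    (hpX : ∀ x ∈ p.support, x ∈ X) (hqY : ∀ x ∈ q.support, x ∈ Y) :
    ∃ c : G.Walk y₁ y₁, c.IsCycle ∧ (∀ x ∈ p.support, x ∈ c.support) ∧
      (∀ x ∈ q.support, x ∈ c.support) ∧ s(x₁, y₁) ∈ c.edges ∧
      (∀ x ∈ c.support, x ∈ X ∨ x ∈ Y) ∧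
      ∀ x ∈ X, ∀ y ∈ Y, s(x, y) ∈ c.edges → (x, y) = (x₁, y₁) ∨ (x, y) = (x₂, y₂) := by
  have hdis : ∀ x, x ∈ X → x ∉ Y := fun x hx hy => Set.disjoint_left.1 hXY hx hy
  have hedge : ∀ x ∈ X, ∀ y ∈ Y, s(x, y) ∉ p.edges ∧ s(x, y) ∉ q.edges := by
    intro x hx y hy
    exact ⟨fun h => hdis y (hpX y (p.snd_mem_support_of_mem_edges h)) hy,
      fun h => hdis x hx (hqY x (q.fst_mem_support_of_mem_edges h))⟩
  have hsym : ∀ x ∈ X, ∀ y ∈ Y, ∀ x' ∈ X, ∀ y' ∈ Y, s(x, y) = s(x', y') → (x, y) = (x', y') := by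
    intro x hx y hy x' hx' y' hy' h
    rcases Sym2.eq_iff.1 h with ⟨rfl, rfl⟩ | ⟨rfl, rfl⟩
    · rfl
    · exact absurd hy' (hdis _ hx)
  have hx₁ := hpX x₁ (by simp)
  have hx₂ := hpX x₂ (by simp)
  have hy₁ := hqY y₁ (by simp)
  have hy₂ := hqY y₂ (by simp)
  refine ⟨Walk.cons a₁.symm (p.append (Walk.cons a₂ q.reverse)), ?_, ?_, ?_, ?_, ?_, ?_⟩
  · rw [Walk.cons_isCycle_iff]
    refine ⟨cc_path_append hp ?_ ?_, ?_⟩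
    · rw [Walk.cons_isPath_iff]
      refine ⟨hq.reverse, fun h => ?_⟩
      rw [Walk.support_reverse, List.mem_reverse] at h
      exact hdis x₂ hx₂ (hqY _ h)
    · intro x hx hx'
      rw [Walk.support_cons, List.mem_cons] at hx'
      rcases hx' with rfl | hx'
      · rfl
      · rw [Walk.support_reverse, List.mem_reverse] at hx'
        exact absurd (hqY _ hx') (hdis x (hpX x hx))
    · rw [Sym2.eq_swap]
      simp only [Walk.edges_append, Walk.edges_cons, Walk.edges_reverse, List.mem_append,
        List.mem_cons, List.mem_reverse]
      rintro (h | h | h)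
      · exact (hedge _ hx₁ _ hy₁).1 h
      · exact hne (hsym _ hx₁ _ hy₁ _ hx₂ _ hy₂ h)
      · exact (hedge _ hx₁ _ hy₁).2 h
  · intro x hx
    simp [hx]
  · intro x hx
    simp [hx]
  · simp [Sym2.eq_swap]
  · intro x hx
    simp only [Walk.support_cons, List.mem_cons, Walk.mem_support_append_iff, Walk.support_reverse,
      List.mem_reverse] at hx
    rcases hx with rfl | hx | rfl | hx
    · exact Or.inr hy₁
    · exact Or.inl (hpX _ hx)
    · exact Or.inl hx₂
    · exact Or.inr (hqY _ hx)
  · intro x hx y hy h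
    simp only [Walk.edges_append, Walk.edges_cons, Walk.edges_reverse, List.mem_append,
        List.mem_cons, List.mem_reverse] at h
    rcases h with h | h | h | h
    · left
      rw [Sym2.eq_swap (a := y₁)] at h
      exact hsym _ hx _ hy _ hx₁ _ hy₁ h
    · exact absurd h (hedge _ hx _ hy).1
    · right
      exact hsym _ hx _ hy _ hx₂ _ hy₂ h
    · exact absurd h (hedge _ hx _ hy).2

/-- The cycle condition of the theorem. -/
def CCCond (G : SimpleGraph V) : Prop :=
  ∀ (u v : V) (c₁ : G.Walk u u) (c₂ : G.Walk v v), c₁.IsCycle → c₂.IsCycle →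
        c₁.toSubgraph.edgeSet ≠ c₂.toSubgraph.edgeSet →
        (c₁.toSubgraph ⊓ c₂.toSubgraph).verts = ∅ ∨
          (c₁.toSubgraph ⊓ c₂.toSubgraph).Connected

lemma cc_contra {G : SimpleGraph V} (hG : CCCond G) {X Y : Set V} (hXY : Disjoint X Y)
    {x₁ x₂ x₃ x₄ y₁ y₂ y₃ y₄ : V}
    (a₁ : G.Adj x₁ y₁) (a₂ : G.Adj x₂ y₂) (a₃ : G.Adj x₃ y₃) (a₄ : G.Adj x₄ y₄)
    (h12 : (x₁, y₁) ≠ (x₂, y₂)) (h13 : (x₁, y₁) ≠ (x₃, y₃)) (h14 : (x₁, y₁) ≠ (x₄, y₄))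
    (h23 : (x₂, y₂) ≠ (x₃, y₃)) (h24 : (x₂, y₂) ≠ (x₄, y₄)) (h34 : (x₃, y₃) ≠ (x₄, y₄))
    (mX : CCMeet G X x₁ x₂ x₃ x₄) (mY : CCMeet G Y y₁ y₂ y₃ y₄) : False := by
  obtain ⟨p, p', hp, hp', hpX, hpX', x, hx, hx'⟩ := mX
  obtain ⟨q, q', hq, hq', hqY, hqY', y, hy, hy'⟩ := mY
  obtain ⟨c, hc, hcp, hcq, hc1, hcs, hce⟩ := cc_cycle hXY a₁ a₂ h12 p q hp hq hpX hqY
  obtain ⟨c', hc', hcp', hcq', -, -, hce'⟩ := cc_cycle hXY a₃ a₄ h34 p' q' hp' hq' hpX' hqY'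
  have hno : ∀ x ∈ X, ∀ y ∈ Y, s(x, y) ∈ c.edges → s(x, y) ∈ c'.edges → False := by
    intro x hx y hy h h'
    rcases hce x hx y hy h with e | e <;> rcases hce' x hx y hy h' with e' | e' <;>
      rw [e] at e' <;> contradiction
  have hxX := hpX x hx
  have hyY := hqY y hy
  have hdiff : c.toSubgraph.edgeSet ≠ c'.toSubgraph.edgeSet := by
    intro heq
    have hm : s(x₁, y₁) ∈ c'.toSubgraph.edgeSet := by
      rw [← heq]
      exact (Walk.mem_edges_toSubgraph _).2 hc1
    exact hno _ (hpX _ (by simp)) _ (hqY _ (by simp)) hc1 ((Walk.mem_edges_toSubgraph _).1 hm)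
  rcases hG _ _ c c' hc hc' hdiff with h | h
  · have : x ∈ (c.toSubgraph ⊓ c'.toSubgraph).verts := by
      simp only [Subgraph.verts_inf, Set.mem_inter_iff, Walk.mem_verts_toSubgraph]
      exact ⟨hcp x hx, hcp' x hx'⟩
    rw [h] at this
    exact this
  · rw [Subgraph.connected_iff_forall_exists_walk_subgraph] at h
    obtain ⟨w, hw⟩ := h.2 (u := x) (v := y)
      (by
        simp only [Subgraph.verts_inf, Set.mem_inter_iff, Walk.mem_verts_toSubgraph]
        exact ⟨hcp x hx, hcp' x hx'⟩)
      (by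
        simp only [Subgraph.verts_inf, Set.mem_inter_iff, Walk.mem_verts_toSubgraph]
        exact ⟨hcq y hy, hcq' y hy'⟩)
    obtain ⟨d, hd, hd1, hd2⟩ := w.exists_boundary_dart X hxX
      (fun h => Set.disjoint_left.1 hXY h hyY)
    have hadj : w.toSubgraph.Adj d.fst d.snd :=
      Walk.adj_toSubgraph_iff_mem_edges.2 (List.mem_map.2 ⟨d, hd, rfl⟩)
    have hadj' := hw.2 hadj
    rw [Subgraph.inf_adj] at hadj'
    have hin1 := Walk.adj_toSubgraph_iff_mem_edges.1 hadj'.1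
    have hin2 := Walk.adj_toSubgraph_iff_mem_edges.1 hadj'.2
    have hcXY : d.snd ∈ Y :=
      (hcs _ (c.snd_mem_support_of_mem_edges hin1)).resolve_left hd2
    exact hno _ hd1 _ hcXY hin1 hin2

lemma cc_backward {G : SimpleGraph V} (hG : CCCond G) : EdgeBottlenecked G 3 := by
  classical
  intro X Y hXY hX hY
  have conn : ∀ Z : Set V, ConnSet G Z → CCWalkConn G Z := by
    intro Z hZ a ha b hb
    obtain ⟨w⟩ := hZ.preconnected ⟨a, ha⟩ ⟨b, hb⟩
    refine ⟨w.map (Embedding.induce Z).toHom, ?_⟩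
    intro x hx
    obtain ⟨z, -, rfl⟩ := List.mem_map.1 ((Walk.support_map (Embedding.induce Z).toHom w) ▸ hx)
    exact z.2
  have hXc := conn X hX
  have hYc := conn Y hY
  let X' : Set V := {v | ∃ x ∈ X, ∃ p : G.Walk x v, ∀ z ∈ p.support, z ∉ Y}
  have hsub : ∀ x ∈ X, x ∈ X' := by
    intro x hx
    refine ⟨x, hx, Walk.nil, ?_⟩
    intro z hz
    rw [Walk.support_nil, List.mem_singleton] at hz
    rw [hz]
    exact Set.disjoint_left.1 hXY hx
  have hdis : Disjoint X' Y := by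
    rw [Set.disjoint_left]
    rintro v ⟨x, hx, p, hp⟩
    exact hp v (by simp)
  have hmem : ∀ {x v : V} (hx : x ∈ X) (p : G.Walk x v), (∀ z ∈ p.support, z ∉ Y) →
      ∀ z ∈ p.support, z ∈ X' := by
    intro x v hx p hp z hz
    exact ⟨x, hx, p.takeUntil z hz, fun y hy => hp y (p.support_takeUntil_subset_support hz hy)⟩
  have hX'c : CCWalkConn G X' := by
    rintro a ⟨x, hx, p, hp⟩ b ⟨x', hx', p', hp'⟩
    obtain ⟨r, hr⟩ := hXc x hx x' hx'
    refine ⟨(p.reverse.append r).append p', ?_⟩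
    intro z hz
    simp only [Walk.mem_support_append_iff, Walk.support_reverse, List.mem_reverse] at hz
    rcases hz with (hz | hz) | hz
    · exact hmem hx p hp z hz
    · exact hsub z (hr z hz)
    · exact hmem hx' p' hp' z hz
  have hstep : ∀ a ∈ X', ∀ b, G.Adj a b → b ∉ X' → b ∈ Y := by
    rintro a ⟨x, hx, p, hp⟩ b hab hb
    by_contra hbY
    apply hb
    refine ⟨x, hx, p.concat hab, ?_⟩
    intro z hz
    rw [Walk.support_concat, List.mem_append, List.mem_singleton] at hz
    rcases hz with hz | rfl
    · exact hp z hz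
    · exact hbY
  by_contra hcon
  push Not at hcon
  have hpick : ∀ T : Finset (V × V), T.card ≤ 3 →
      ∃ x y, x ∈ X' ∧ y ∈ Y ∧ G.Adj x y ∧ (x, y) ∉ T := by
    intro T hT
    obtain ⟨x, y, p, hx, hy, -, hp⟩ := hcon (T.image fun e => s(e.1, e.2))
      (Finset.card_image_le.trans hT)
    obtain ⟨d, hd, hd1, hd2⟩ := p.exists_boundary_dart X' (hsub x hx)
      (fun h => Set.disjoint_left.1 hdis h hy)
    refine ⟨d.fst, d.snd, hd1, hstep _ hd1 _ d.adj hd2, d.adj, fun h => ?_⟩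
    exact hp s(d.fst, d.snd) (Finset.mem_image.2 ⟨_, h, rfl⟩) (List.mem_map.2 ⟨d, hd, rfl⟩)
  obtain ⟨x₁, y₁, hx₁, hy₁, a₁, -⟩ := hpick ∅ (by simp)
  obtain ⟨x₂, y₂, hx₂, hy₂, a₂, n₂⟩ := hpick {(x₁, y₁)} (by simp)
  obtain ⟨x₃, y₃, hx₃, hy₃, a₃, n₃⟩ := hpick {(x₁, y₁), (x₂, y₂)}
    (Finset.card_le_two.trans (by norm_num))
  obtain ⟨x₄, y₄, hx₄, hy₄, a₄, n₄⟩ := hpick {(x₁, y₁), (x₂, y₂), (x₃, y₃)} Finset.card_le_three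
  simp only [Finset.mem_insert, Finset.mem_singleton, not_or] at n₂ n₃ n₄
  obtain ⟨n₁₃, n₂₃⟩ := n₃
  obtain ⟨n₁₄, n₂₄, n₃₄⟩ := n₄
  have A : ¬ (CCMeet G X' x₁ x₂ x₃ x₄ ∧ CCMeet G Y y₁ y₂ y₃ y₄) := fun h =>
    cc_contra hG hdis a₁ a₂ a₃ a₄ (Ne.symm n₂) (Ne.symm n₁₃) (Ne.symm n₁₄) (Ne.symm n₂₃)
      (Ne.symm n₂₄) (Ne.symm n₃₄) h.1 h.2
  have B : ¬ (CCMeet G X' x₁ x₃ x₂ x₄ ∧ CCMeet G Y y₁ y₃ y₂ y₄) := fun h =>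
    cc_contra hG hdis a₁ a₃ a₂ a₄ (Ne.symm n₁₃) (Ne.symm n₂) (Ne.symm n₁₄) n₂₃
      (Ne.symm n₃₄) (Ne.symm n₂₄) h.1 h.2
  have C : ¬ (CCMeet G X' x₁ x₄ x₂ x₃ ∧ CCMeet G Y y₁ y₄ y₂ y₃) := fun h =>
    cc_contra hG hdis a₁ a₄ a₂ a₃ (Ne.symm n₁₄) (Ne.symm n₂) (Ne.symm n₁₃) n₂₄
      n₃₄ (Ne.symm n₂₃) h.1 h.2
  have three : ∀ {Z : Set V} (_ : CCWalkConn G Z) {z₁ z₂ z₃ z₄ : V} (_ : z₁ ∈ Z) (_ : z₂ ∈ Z)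
      (_ : z₃ ∈ Z) (_ : z₄ ∈ Z),
      (CCMeet G Z z₁ z₂ z₃ z₄ ∨ CCMeet G Z z₁ z₃ z₂ z₄) ∧
      (CCMeet G Z z₁ z₂ z₃ z₄ ∨ CCMeet G Z z₁ z₄ z₂ z₃) ∧
      (CCMeet G Z z₁ z₃ z₂ z₄ ∨ CCMeet G Z z₁ z₄ z₂ z₃) := by
    intro Z hZ z₁ z₂ z₃ z₄ h₁ h₂ h₃ h₄
    refine ⟨cc_meet hZ h₁ h₂ h₃ h₄, ?_, ?_⟩
    · exact (cc_meet hZ h₁ h₂ h₄ h₃).imp CCMeet.swap_right id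
    · exact (cc_meet hZ h₁ h₃ h₄ h₂).imp CCMeet.swap_right CCMeet.swap_right
  have tX := three hX'c hx₁ hx₂ hx₃ hx₄
  have tY := three hYc hy₁ hy₂ hy₃ hy₄
  tauto

/-- A graph is `3`-edge bottlenecked iff the intersection of any two distinct cycles
is empty or connected. -/
theorem threeBottlenecked_iff_cutCactus (G : SimpleGraph V) :
    EdgeBottlenecked G 3 ↔
      ∀ (u v : V) (c₁ : G.Walk u u) (c₂ : G.Walk v v), c₁.IsCycle → c₂.IsCycle →
        c₁.toSubgraph.edgeSet ≠ c₂.toSubgraph.edgeSet →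
        (c₁.toSubgraph ⊓ c₂.toSubgraph).verts = ∅ ∨
          (c₁.toSubgraph ⊓ c₂.toSubgraph).Connected := by
  constructor
  · intro hG u v c₁ c₂ h₁ h₂ _
    rcases Set.eq_empty_or_nonempty (c₁.toSubgraph ⊓ c₂.toSubgraph).verts with h | h
    · exact Or.inl h
    · exact Or.inr (cc_forward G hG c₁ c₂ h₁ h₂ h)
  · intro hG
    exact cc_backward hG
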